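/- There exists N such that for all n ≥ N the following holds. Let X be a distribution on {0,1}^n and x* ∈ {0,1}^n such that 1/(6n) ≤ X(x*) ≤ 1 − 1/n and X(x') ≤ 2/n^600 for every x' ≠ x*. Let A₀ be the distribution of the pair (r, ⟨x,r⟩) with r ← U_n and x ← X sampled independently, and let A₁ be the distribution of the pair (r, b) where r ← U_n, x ← X are independent and b is a uniform bit independent of r if x = x*, while b = ⟨x,r⟩ otherwise. Then H(A₁) − H(A₀) ≥ 1/(100 n²). -/

import Mathlib

/-- The base-2 Shannon entropy of a distribution `P` on a finite set,
with the convention `0 * log₂ 0 = 0` (note `Real.logb 2 0 = 0`). -/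
noncomputable def shannonH {S : Type*} [Fintype S] (P : S → ℝ) : ℝ :=
  ∑ x, -(P x * Real.logb 2 (P x))

/-- `P` is a probability distribution on the finite set `S`. -/
def IsDist {S : Type*} [Fintype S] (P : S → ℝ) : Prop :=
  (∀ x, 0 ≤ P x) ∧ (∑ x, P x) = 1

/-- Boolean inner product of two length-`n` bit strings. -/
def ip {n : ℕ} (x r : Fin n → ZMod 2) : ZMod 2 := ∑ i, x i * r i

/-- The character `b ↦ (-1)^b` of `ZMod 2`, as a real number. -/
def bitSign (b : ZMod 2) : ℝ := if b = 0 then 1 else -1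

theorem bitSign_add (a b : ZMod 2) : bitSign (a + b) = bitSign a * bitSign b := by
  have h : ∀ a : ZMod 2, a = 0 ∨ a = 1 := by decide
  have h11 : (1 + 1 : ZMod 2) = 0 := by decide
  rcases h a with rfl | rfl <;> rcases h b with rfl | rfl <;> simp [bitSign, h11]

theorem bitSign_mul_self (a : ZMod 2) : bitSign a * bitSign a = 1 := by
  unfold bitSign; split_ifs <;> norm_num

theorem abs_bitSign (a : ZMod 2) : |bitSign a| = 1 := by
  unfold bitSign; split_ifs <;> norm_num

theorem ite_eq_bitSign (a b : ZMod 2) (y : ℝ) :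
    (if a = b then y else 0) = y * (1 + bitSign b * bitSign a) / 2 := by
  have h : ∀ a : ZMod 2, a = 0 ∨ a = 1 := by decide
  rcases h a with rfl | rfl <;> rcases h b with rfl | rfl <;> norm_num [bitSign]

theorem ip_add_right {n : ℕ} (x r s : Fin n → ZMod 2) : ip x (r + s) = ip x r + ip x s := by
  simp [ip, mul_add, Finset.sum_add_distrib]

theorem ip_single {n : ℕ} (x : Fin n → ZMod 2) (i : Fin n) : ip x (Pi.single i 1) = x i := by
  simp [ip, Pi.single_apply]

theorem sum_bitSign_ip_mul {n : ℕ} (x y : Fin n → ZMod 2) :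
    ∑ r, bitSign (ip x r) * bitSign (ip y r) = if x = y then (2 : ℝ) ^ n else 0 := by
  split_ifs with h
  · subst h
    simp [bitSign_mul_self, ZMod.card]
  · obtain ⟨i, hi⟩ := Function.ne_iff.mp h
    have hflip : bitSign (x i) * bitSign (y i) = -1 := by
      have hb : ∀ a : ZMod 2, a = 0 ∨ a = 1 := by decide
      rcases hb (x i) with hx | hx <;> rcases hb (y i) with hy | hy <;>
        simp_all [bitSign]
    have hs := Equiv.sum_comp (Equiv.addRight (Pi.single i 1 : Fin n → ZMod 2))
      (fun r => bitSign (ip x r) * bitSign (ip y r))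
    have hneg : ∀ r : Fin n → ZMod 2,
        bitSign (ip x (r + Pi.single i 1)) * bitSign (ip y (r + Pi.single i 1))
          = -(bitSign (ip x r) * bitSign (ip y r)) := by
      intro r
      simp only [ip_add_right, ip_single, bitSign_add]
      linear_combination bitSign (ip x r) * bitSign (ip y r) * hflip
    simp only [Equiv.coe_addRight, hneg, Finset.sum_neg_distrib] at hs
    linarith

/-- The Walsh–Hadamard transform of a real function on bit strings. -/
def walsh {n : ℕ} (Y : (Fin n → ZMod 2) → ℝ) (r : Fin n → ZMod 2) : ℝ :=
  ∑ x, Y x * bitSign (ip x r)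

theorem sum_walsh_sq {n : ℕ} (Y : (Fin n → ZMod 2) → ℝ) :
    ∑ r, walsh Y r ^ 2 = 2 ^ n * ∑ x, Y x ^ 2 := by
  have h : ∀ r, walsh Y r ^ 2
      = ∑ x, ∑ y, Y x * Y y * (bitSign (ip x r) * bitSign (ip y r)) := by
    intro r
    rw [walsh, sq, Finset.sum_mul_sum]
    refine Finset.sum_congr rfl fun x _ => Finset.sum_congr rfl fun y _ => by ring
  simp_rw [h]
  rw [Finset.sum_comm, Finset.mul_sum]
  refine Finset.sum_congr rfl fun x _ => ?_
  rw [Finset.sum_comm]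
  simp_rw [← Finset.mul_sum, sum_bitSign_ip_mul]
  simp only [mul_ite, mul_zero, Finset.sum_ite_eq, Finset.mem_univ, if_true]
  ring

theorem abs_walsh_le {n : ℕ} {Y : (Fin n → ZMod 2) → ℝ} (hY : ∀ x, 0 ≤ Y x)
    (r : Fin n → ZMod 2) : |walsh Y r| ≤ ∑ x, Y x := by
  refine (Finset.abs_sum_le_sum_abs _ _).trans (Finset.sum_le_sum fun x _ => ?_)
  rw [abs_mul, abs_bitSign, mul_one, abs_of_nonneg (hY x)]

theorem sum_ite_ip_eq {n : ℕ} (Y : (Fin n → ZMod 2) → ℝ) (r : Fin n → ZMod 2) (b : ZMod 2) :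
    (∑ x, if ip x r = b then Y x else 0) = (∑ x, Y x + bitSign b * walsh Y r) / 2 := by
  simp_rw [ite_eq_bitSign]
  rw [walsh, Finset.mul_sum, ← Finset.sum_add_distrib, Finset.sum_div]
  exact Finset.sum_congr rfl fun x _ => by ring

/-- Twice the relative entropy (in nats) of a bit of bias `u` with respect to a uniform bit. -/
noncomputable def biasDivergence (u : ℝ) : ℝ :=
  (1 + u) * Real.log (1 + u) + (1 - u) * Real.log (1 - u)

theorem mul_log_le {t : ℝ} (ht : 0 ≤ t) : t * Real.log t ≤ t * (t - 1) := by
  rcases ht.eq_or_lt with rfl | h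
  · simp
  · exact mul_le_mul_of_nonneg_left (Real.log_le_sub_one_of_pos h) ht

theorem biasDivergence_le {u : ℝ} (hu : |u| ≤ 1) : biasDivergence u ≤ 2 * u ^ 2 := by
  obtain ⟨h1, h2⟩ := abs_le.mp hu
  have ha := mul_log_le (t := 1 + u) (by linarith)
  have hb := mul_log_le (t := 1 - u) (by linarith)
  unfold biasDivergence
  nlinarith

theorem two_mul_le_log_sub_log {u : ℝ} (h0 : 0 ≤ u) (h1 : u < 1) :
    2 * u ≤ Real.log (1 + u) - Real.log (1 - u) := by
  have hpos : 0 < 1 - u := by linarith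
  have h := Real.le_log_one_add_of_nonneg (x := 2 * u / (1 - u)) (by positivity)
  rw [← Real.log_div (by linarith) hpos.ne']
  convert h using 1
  · field_simp
    ring
  · congr 1
    field_simp
    ring

theorem sq_le_biasDivergence_of_nonneg {u : ℝ} (h0 : 0 ≤ u) (h1 : u ≤ 1) :
    u ^ 2 ≤ biasDivergence u := by
  have hmono : MonotoneOn (fun u => biasDivergence u - u ^ 2) (Set.Icc 0 1) := by
    refine monotoneOn_of_hasDerivWithinAt_nonneg (convex_Icc 0 1)
      (f' := fun u => Real.log (1 + u) - Real.log (1 - u) - 2 * u) ?_ ?_ ?_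
    · refine Continuous.continuousOn (Continuous.sub (Continuous.add ?_ ?_) (by fun_prop))
      · exact Real.continuous_mul_log.comp (continuous_const.add continuous_id)
      · exact Real.continuous_mul_log.comp (continuous_const.sub continuous_id)
    · intro v hv
      rw [interior_Icc] at hv
      have ha := (Real.hasDerivAt_mul_log (x := 1 + v) (by linarith [hv.1])).comp v
        ((hasDerivAt_id v).const_add 1)
      have hb := (Real.hasDerivAt_mul_log (x := 1 - v) (by linarith [hv.2])).comp v
        ((hasDerivAt_id v).const_sub 1)
      have hc := (ha.add hb).sub (hasDerivAt_pow 2 v)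
      refine HasDerivAt.hasDerivWithinAt (hc.congr_deriv ?_)
      norm_num
      ring
    · intro v hv
      rw [interior_Icc] at hv
      linarith [two_mul_le_log_sub_log hv.1.le hv.2]
  have h := hmono (Set.left_mem_Icc.mpr zero_le_one) ⟨h0, h1⟩ h0
  simpa [biasDivergence] using h

theorem sq_le_biasDivergence {u : ℝ} (hu : |u| ≤ 1) : u ^ 2 ≤ biasDivergence u := by
  have h := sq_le_biasDivergence_of_nonneg (abs_nonneg u) hu
  rcases abs_cases u with ⟨h', _⟩ | ⟨h', _⟩ <;> rw [h'] at h
  · exact h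
  · simp only [biasDivergence, neg_sq, sub_neg_eq_add, ← sub_eq_add_neg] at h
    unfold biasDivergence
    linarith

/-- Entropy of the pair of a uniform element of a set of size `1 / c` and a bit whose bias is
determined by that element. -/
theorem shannonH_biased_bit {R : Type*} [Fintype R] {c : ℝ} (hc : c ≠ 0) (u : R → ℝ) :
    shannonH (fun p : R × ZMod 2 => c * ((1 + bitSign p.2 * u p.1) / 2))
      = ∑ r, (-(c * Real.log (c / 2)) - c / 2 * biasDivergence (u r)) / Real.log 2 := by
  have hsplit : ∀ t : ℝ, c * (t / 2) * Real.log (c * (t / 2))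
      = c / 2 * (t * Real.log (c / 2) + t * Real.log t) := by
    intro t
    rcases eq_or_ne t 0 with rfl | ht
    · simp
    · rw [show c * (t / 2) = c / 2 * t by ring,
        Real.log_mul (div_ne_zero hc two_ne_zero) ht]
      ring
  have huniv : (Finset.univ : Finset (ZMod 2)) = {0, 1} := by decide
  rw [shannonH, Fintype.sum_prod_type]
  refine Finset.sum_congr rfl fun r _ => ?_
  rw [huniv, Finset.sum_pair (by decide)]
  simp only [Real.logb, ← mul_div_assoc (c * _) (Real.log _), hsplit]
  simp only [bitSign, biasDivergence, if_true, one_ne_zero, if_false, one_mul, neg_one_mul,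
    ← sub_eq_add_neg]
  ring

theorem shannonH_biased_bit_sub_ge {R : Type*} [Fintype R] {c : ℝ} (hc : 0 < c) {u v : R → ℝ}
    (hu : ∀ r, |u r| ≤ 1) (hv : ∀ r, |v r| ≤ 1) :
    c * (∑ r, v r ^ 2 - 2 * ∑ r, u r ^ 2) / (2 * Real.log 2)
      ≤ shannonH (fun p : R × ZMod 2 => c * ((1 + bitSign p.2 * u p.1) / 2))
        - shannonH (fun p : R × ZMod 2 => c * ((1 + bitSign p.2 * v p.1) / 2)) := by
  have hlog : 0 < Real.log 2 := Real.log_pos one_lt_two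
  rw [shannonH_biased_bit hc.ne', shannonH_biased_bit hc.ne', ← Finset.sum_sub_distrib,
    Finset.mul_sum, ← Finset.sum_sub_distrib, Finset.mul_sum, Finset.sum_div]
  refine Finset.sum_le_sum fun r _ => ?_
  rw [← sub_div, div_le_div_iff₀ (by positivity) hlog]
  have h1 := biasDivergence_le (hu r)
  have h2 := sq_le_biasDivergence (hv r)
  have h3 : c * (v r ^ 2 - 2 * u r ^ 2)
      ≤ c * (biasDivergence (v r) - biasDivergence (u r)) := by
    gcongr
  nlinarith

/- `A₀` is the distribution of `(r, ⟨x,r⟩)` for independent `r ← U_n`, `x ← X`;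
`A₁` is the distribution of `(r, b)` where `b` is a uniform independent bit if `x = x*`
and `b = ⟨x,r⟩` otherwise. -/
theorem stmt6 :
    ∃ N : ℕ, ∀ n : ℕ, N ≤ n →
      ∀ X : (Fin n → ZMod 2) → ℝ, IsDist X →
      ∀ xs : Fin n → ZMod 2,
        1 / (6 * (n : ℝ)) ≤ X xs →
        X xs ≤ 1 - 1 / (n : ℝ) →
        (∀ x', x' ≠ xs → X x' ≤ 2 / (n : ℝ) ^ 600) →
        shannonH (fun p : (Fin n → ZMod 2) × ZMod 2 =>
              (1 / 2 ^ n) * (X xs / 2 + ∑ x, if x ≠ xs ∧ ip x p.1 = p.2 then X x else 0))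
          - shannonH (fun p : (Fin n → ZMod 2) × ZMod 2 =>
              (1 / 2 ^ n) * ∑ x, if ip x p.1 = p.2 then X x else 0)
          ≥ 1 / (100 * (n : ℝ) ^ 2) := by
  refine ⟨1000, fun n hn X hX xs hlow _ hsmall => ?_⟩
  obtain ⟨hnn, hsum⟩ := hX
  set Y : (Fin n → ZMod 2) → ℝ := fun x => if x ≠ xs then X x else 0 with hY
  have hYnn : ∀ x, 0 ≤ Y x := fun x => by
    simp only [hY]; split_ifs; exacts [hnn x, le_rfl]
  have hsplit : ∀ f : ℝ → ℝ, f 0 = 0 → ∑ x, f (X x) = f (X xs) + ∑ x, f (Y x) := by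
    intro f hf
    rw [← Finset.add_sum_erase _ _ (Finset.mem_univ xs),
      ← Finset.add_sum_erase _ (fun x => f (Y x)) (Finset.mem_univ xs)]
    simp only [hY, ne_eq, not_true_eq_false, if_false, hf, zero_add]
    congr 1
    exact Finset.sum_congr rfl fun x hx => by rw [if_pos (Finset.ne_of_mem_erase hx)]
  have hYsum : X xs + ∑ x, Y x = 1 := (hsplit id rfl).symm.trans hsum
  have hsq := hsplit (fun t => t ^ 2) (by norm_num)
  have hA₁ : (fun p : (Fin n → ZMod 2) × ZMod 2 =>
      (1 / 2 ^ n) * (X xs / 2 + ∑ x, if x ≠ xs ∧ ip x p.1 = p.2 then X x else 0))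
      = fun p => (1 / 2 ^ n : ℝ) * ((1 + bitSign p.2 * walsh Y p.1) / 2) := by
    funext p
    have h : ∀ x, (if x ≠ xs ∧ ip x p.1 = p.2 then X x else 0)
        = if ip x p.1 = p.2 then Y x else 0 := fun x => by
      simp only [hY]; split_ifs <;> simp_all
    simp_rw [h]
    rw [sum_ite_ip_eq, ← hYsum]
    ring
  have hA₀ : (fun p : (Fin n → ZMod 2) × ZMod 2 =>
      (1 / 2 ^ n) * ∑ x, if ip x p.1 = p.2 then X x else 0)
      = fun p => (1 / 2 ^ n : ℝ) * ((1 + bitSign p.2 * walsh X p.1) / 2) := by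
    funext p
    rw [sum_ite_ip_eq, hsum]
  rw [hA₁, hA₀]
  refine le_trans ?_ (shannonH_biased_bit_sub_ge (by positivity)
    (fun r => (abs_walsh_le hYnn r).trans (by linarith [hnn xs]))
    (fun r => (abs_walsh_le hnn r).trans hsum.le))
  rw [sum_walsh_sq, sum_walsh_sq, hsq]
  have hn' : (1000 : ℝ) ≤ n := by exact_mod_cast hn
  have hYsq : ∑ x, Y x ^ 2 ≤ 2 / (n : ℝ) ^ 600 := by
    calc ∑ x, Y x ^ 2 ≤ ∑ x, 2 / (n : ℝ) ^ 600 * Y x := by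
          refine Finset.sum_le_sum fun x _ => ?_
          rw [sq]
          refine mul_le_mul_of_nonneg_right ?_ (hYnn x)
          simp only [hY]
          split_ifs with h
          exacts [hsmall x h, by positivity]
      _ ≤ 2 / (n : ℝ) ^ 600 * 1 := by
          rw [← Finset.mul_sum]
          gcongr
          linarith [hnn xs]
      _ = _ := mul_one _
  have htiny : 2 / (n : ℝ) ^ 600 ≤ 2 / 1000 * (1 / (n : ℝ) ^ 2) := by
    have hpow : (1000 : ℝ) * (n : ℝ) ^ 2 ≤ (n : ℝ) ^ 600 := by
      calc (1000 : ℝ) * (n : ℝ) ^ 2 ≤ (n : ℝ) * (n : ℝ) ^ 2 := by gcongr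
        _ = (n : ℝ) ^ 3 := by ring
        _ ≤ (n : ℝ) ^ 600 := pow_le_pow_right₀ (by linarith) (by norm_num)
    calc 2 / (n : ℝ) ^ 600 ≤ 2 / (1000 * n ^ 2) := by gcongr
      _ = _ := by field_simp
  have hmass : 1 / 36 * (1 / (n : ℝ) ^ 2) ≤ X xs ^ 2 := by
    calc 1 / 36 * (1 / (n : ℝ) ^ 2) = (1 / (6 * (n : ℝ))) ^ 2 := by field_simp; norm_num
      _ ≤ _ := by gcongr
  have hq : 0 < 1 / (n : ℝ) ^ 2 := by positivity
  have hlog : 0 < Real.log 2 := Real.log_pos one_lt_two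
  have hlog' : Real.log 2 ≤ 1 := by linarith [Real.log_two_lt_d9]
  rw [le_div_iff₀ (by positivity)]
  have hcancel : ∀ a b : ℝ, 1 / (2 : ℝ) ^ n * (2 ^ n * a - 2 * (2 ^ n * b)) = a - 2 * b := by
    intro a b
    field_simp
  rw [hcancel]
  calc 1 / (100 * (n : ℝ) ^ 2) * (2 * Real.log 2)
      ≤ 1 / (100 * (n : ℝ) ^ 2) * (2 * 1) := by gcongr
    _ = 1 / 50 * (1 / (n : ℝ) ^ 2) := by field_simp; norm_num
    _ ≤ _ := by linarith
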